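/- Let $m \geq 1$, $n \geq 2$, and integers $i_1,\dots,i_m \geq 0$ with $|i| = i_1 + \cdots + i_m \leq n$, and let $A, B_1,\dots,B_m$ be $n\times n$ positive semi-definite symmetric matrices. Then $\det(A)^{m-1} D(B_1[i_1],\dots,B_m[i_m],A[n-|i|]) \leq \frac{(n!)^{m-1}(n-|i|)!}{\prod_{j=1}^m (n-i_j)!} \prod_{k=1}^m D(B_k[i_k], A[n-i_k])$. -/

import Mathlib

/-- The mixed discriminant of `n` matrices, via the polarization
(inclusion-exclusion) formula. -/
noncomputable def mixedDisc {n : ℕ} (M : Fin n → Matrix (Fin n) (Fin n) ℝ) : ℝ :=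
  ((n.factorial : ℝ))⁻¹ *
    ∑ S : Finset (Fin n), (-1 : ℝ) ^ (n + S.card) * (∑ i ∈ S, M i).det

/-- The list `B 0` repeated `i 0` times, then `B 1` repeated `i 1` times, etc. -/
def blocks {α : Type*} {m : ℕ} (i : Fin m → ℕ) (B : Fin m → α) : List α :=
  (List.ofFn fun k => List.replicate (i k) (B k)).flatten

open Matrix in
theorem aux_exists_factor {ι : Type*} [Fintype ι] [DecidableEq ι] {Q : Matrix ι ι ℝ}
    (hQ : Q.PosDef) : ∃ C : Matrix ι ι ℝ, Q = Cᵀ * C ∧ IsUnit C.det := by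
  open scoped MatrixOrder in
  obtain ⟨C, hC⟩ := CStarAlgebra.nonneg_iff_eq_star_mul_self.mp hQ.posSemidef.nonneg
  have h1 : Q = Cᵀ * C := by
    rw [hC]; congr 1
  refine ⟨C, h1, ?_⟩
  have h2 := hQ.det_pos
  rw [h1, det_mul, det_transpose] at h2
  rw [isUnit_iff_ne_zero]
  intro h0
  simp [h0] at h2

open Matrix in
theorem aux_det_le_exp {ι : Type*} [Fintype ι] [DecidableEq ι] {Z : Matrix ι ι ℝ}
    (hZ : Z.PosSemidef) (ht : Z.trace = Fintype.card ι) : Z.det ≤ 1 := by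
  have h1 := hZ.1.det_eq_prod_eigenvalues
  have h2 := hZ.1.trace_eq_sum_eigenvalues
  simp only [RCLike.ofReal_real_eq_id, id_eq] at h1 h2
  rw [h1]
  calc ∏ i, hZ.1.eigenvalues i ≤ ∏ i, Real.exp (hZ.1.eigenvalues i - 1) := by
        apply Finset.prod_le_prod
        · intro i _; exact hZ.eigenvalues_nonneg i
        · intro i _
          have := Real.add_one_le_exp (hZ.1.eigenvalues i - 1)
          linarith
    _ = 1 := by
        rw [← Real.exp_sum, Finset.sum_sub_distrib, ← h2, ht]
        simp

open Matrix in
theorem aux_det_le {ι : Type*} [Fintype ι] [DecidableEq ι] {P Q R : Matrix ι ι ℝ}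
    (hP : P.PosSemidef) (hQ : Q.PosDef) (hR : R * Q = 1)
    (ht : (R * P).trace = Fintype.card ι) : P.det ≤ Q.det := by
  obtain ⟨C, hC, hu⟩ := aux_exists_factor hQ
  have hCi : C * C⁻¹ = 1 := mul_nonsing_inv C hu
  have hiC : C⁻¹ * C = 1 := nonsing_inv_mul C hu
  have hRe : R = C⁻¹ * (C⁻¹)ᵀ := by
    have : R * Q * (C⁻¹ * (C⁻¹)ᵀ) = R := by
      rw [hC]
      have : R * (Cᵀ * C) * (C⁻¹ * (C⁻¹)ᵀ) = R * (Cᵀ * ((C * C⁻¹) * (C⁻¹)ᵀ)) := by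
        simp only [Matrix.mul_assoc]
      rw [this, hCi, Matrix.one_mul, ← transpose_mul, hiC, transpose_one, Matrix.mul_one]
    rw [← this, hR, Matrix.one_mul]
  have hZ : ((C⁻¹)ᵀ * P * C⁻¹).PosSemidef := by
    have := hP.conjTranspose_mul_mul_same C⁻¹
    simpa using this
  have h1 := aux_det_le_exp hZ (by
    rw [← ht, hRe, trace_mul_comm, ← Matrix.mul_assoc])
  have h2 : P.det = Q.det * ((C⁻¹)ᵀ * P * C⁻¹).det := by
    have h3 : C.det * (C⁻¹).det = 1 := by rw [← det_mul, hCi, det_one]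
    rw [hC]
    simp only [det_mul, det_transpose]
    calc P.det = (C.det * (C⁻¹).det) * (C.det * (C⁻¹).det) * P.det := by rw [h3]; ring
      _ = _ := by ring
  rw [h2]
  exact mul_le_of_le_one_right hQ.det_pos.le h1

open Matrix in
theorem aux_det_zero {α β : Type*} [Fintype α] [DecidableEq α] [Fintype β] [DecidableEq β]
    {A : Matrix α α ℝ} {B : Matrix α β ℝ} {C : Matrix β α ℝ} {D : Matrix β β ℝ}
    (hP : (fromBlocks A B C D).PosSemidef) (hA : A.det = 0) : (fromBlocks A B C D).det = 0 := by
  obtain ⟨v, hv, h0⟩ := exists_mulVec_eq_zero_iff.mpr hA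
  apply exists_mulVec_eq_zero_iff.mp
  refine ⟨Sum.elim v 0, ?_, ?_⟩
  · intro h
    apply hv
    ext a
    exact congrFun h (Sum.inl a)
  · rw [← hP.dotProduct_mulVec_zero_iff, fromBlocks_mulVec]
    simp [h0, dotProduct]

open Matrix in
theorem aux_fischer {α β : Type*} [Fintype α] [DecidableEq α] [Fintype β] [DecidableEq β]
    {A : Matrix α α ℝ} {B : Matrix α β ℝ} {C : Matrix β α ℝ} {D : Matrix β β ℝ}
    (hP : (fromBlocks A B C D).PosSemidef) :
    (fromBlocks A B C D).det ≤ A.det * D.det := by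
  have hA : A.PosSemidef := hP.submatrix Sum.inl
  have hD : D.PosSemidef := hP.submatrix Sum.inr
  by_cases hA0 : A.det = 0
  · rw [aux_det_zero hP hA0, hA0, zero_mul]
  by_cases hD0 : D.det = 0
  · have hP' : (fromBlocks D C B A).PosSemidef := by
      have := hP.submatrix (Equiv.sumComm β α)
      simpa using this
    have : (fromBlocks A B C D).det = (fromBlocks D C B A).det := by
      rw [← det_submatrix_equiv_self (Equiv.sumComm β α) (fromBlocks A B C D)]
      simp
    rw [this, aux_det_zero hP' hD0, hD0, mul_zero]
  have hA' := hA.posDef_iff_det_ne_zero.mpr hA0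
  have hD' := hD.posDef_iff_det_ne_zero.mpr hD0
  have hQ0 : (fromBlocks A 0 0 D).PosSemidef := by
    let _ : Invertible A := A.invertibleOfIsUnitDet (isUnit_iff_ne_zero.mpr hA0)
    have := (Matrix.PosDef.fromBlocks₁₁ (0 : Matrix α β ℝ) D hA').mpr (by simpa using hD)
    simpa using this
  have hQd : (fromBlocks A 0 0 D).det = A.det * D.det := by simp
  have hQ := hQ0.posDef_iff_det_ne_zero.mpr (by rw [hQd]; exact mul_ne_zero hA0 hD0)
  rw [← hQd]
  have hAi : A⁻¹ * A = 1 := nonsing_inv_mul A (isUnit_iff_ne_zero.mpr hA0)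
  have hDi : D⁻¹ * D = 1 := nonsing_inv_mul D (isUnit_iff_ne_zero.mpr hD0)
  apply aux_det_le (R := fromBlocks A⁻¹ 0 0 D⁻¹) hP hQ
  · rw [fromBlocks_multiply]; simp [hAi, hDi]
  · rw [fromBlocks_multiply]; simp [hAi, hDi, trace]

/-- Gram determinant of the sub-family indexed by `S`. -/
noncomputable def auxGram {ι : Type*} [DecidableEq ι] {n : ℕ} (S : Finset ι) (u : ι → Fin n → ℝ) : ℝ :=
  ((Matrix.of fun a : S => u a) * (Matrix.of fun a : S => u a).transpose).det

open Matrix in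
theorem auxGram_union {ι : Type*} [DecidableEq ι] {n : ℕ} (S T : Finset ι) (h : Disjoint S T)
    (u : ι → Fin n → ℝ) :
    auxGram (S ∪ T) u = (fromBlocks
      ((of fun a : S => u a) * (of fun a : S => u a)ᵀ) ((of fun a : S => u a) * (of fun a : T => u a)ᵀ)
      ((of fun a : T => u a) * (of fun a : S => u a)ᵀ)
      ((of fun a : T => u a) * (of fun a : T => u a)ᵀ)).det := by
  unfold auxGram
  rw [← det_submatrix_equiv_self (Equiv.Finset.union S T h)]
  congr 1
  ext (a | a) (b | b) <;> simp [mul_apply]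

open Matrix in
theorem aux_gram_psd {α β : Type*} [Fintype α] [Fintype β] {n : ℕ}
    (X : Matrix α (Fin n) ℝ) (Y : Matrix β (Fin n) ℝ) :
    (fromBlocks (X * Xᵀ) (X * Yᵀ) (Y * Xᵀ) (Y * Yᵀ)).PosSemidef := by
  have := posSemidef_self_mul_conjTranspose (fromRows X Y)
  rw [conjTranspose_eq_transpose_of_trivial, transpose_fromRows, fromRows_mul_fromCols] at this
  exact this

theorem auxGram_nonneg {ι : Type*} [DecidableEq ι] {n : ℕ} (S : Finset ι) (u : ι → Fin n → ℝ) :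
    0 ≤ auxGram S u := by
  unfold auxGram
  have := Matrix.posSemidef_self_mul_conjTranspose (Matrix.of fun a : S => u a)
  exact Matrix.PosSemidef.det_nonneg (by simpa using this)

theorem auxGram_fischer {ι : Type*} [DecidableEq ι] {n : ℕ} (S T : Finset ι) (h : Disjoint S T)
    (u : ι → Fin n → ℝ) : auxGram (S ∪ T) u ≤ auxGram S u * auxGram T u := by
  rw [auxGram_union S T h]
  refine (aux_fischer (aux_gram_psd _ _)).trans (le_of_eq ?_)
  rfl

open Matrix in
theorem auxGram_step {ι : Type*} [DecidableEq ι] {n : ℕ} (S : Finset ι) (j : ι) (hj : j ∉ S)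
    (u : ι → Fin n → ℝ) :
    ∑ l : Fin n, auxGram (S ∪ {j}) (Function.update u j (Pi.single l 1))
      = ((n : ℝ) - S.card) * auxGram S u := by
  have hd : Disjoint S {j} := by simpa using hj
  have hS : ∀ l : Fin n, (of fun a : S => (Function.update u j (Pi.single l 1) : ι → Fin n → ℝ) a) =
      (of fun a : S => u a) := by
    intro l
    ext a b
    have : (a : ι) ≠ j := fun h => hj (h ▸ a.2)
    simp [this]
  have hG : ∀ l : Fin n, auxGram S (Function.update u j (Pi.single l 1)) = auxGram S u := by
    intro l
    unfold auxGram
    rw [hS]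
  by_cases h0 : auxGram S u = 0
  · rw [h0, mul_zero]
    apply Finset.sum_eq_zero
    intro l _
    have := auxGram_fischer S {j} hd (Function.update u j (Pi.single l 1))
    rw [hG, h0, zero_mul] at this
    exact le_antisymm this (auxGram_nonneg _ _)
  set X : Matrix S (Fin n) ℝ := of fun a : S => u a with hX
  have hg : auxGram S u = (X * Xᵀ).det := by rfl
  have hu : IsUnit (X * Xᵀ).det := by rw [← hg]; exact isUnit_iff_ne_zero.mpr h0
  let _ : Invertible (X * Xᵀ) := (X * Xᵀ).invertibleOfIsUnitDet hu
  have key : ∀ l : Fin n, auxGram (S ∪ {j}) (Function.update u j (Pi.single l 1))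
      = auxGram S u * (1 - (Xᵀ * ((X * Xᵀ)⁻¹ * X)) l l) := by
    intro l
    rw [auxGram_union S {j} hd, hS, det_fromBlocks₁₁, hg]
    congr 1
    rw [det_unique]
    set Y : Matrix ({j} : Finset ι) (Fin n) ℝ :=
      of fun a : ({j} : Finset ι) => (Function.update u j (Pi.single l 1) : ι → Fin n → ℝ) a with hY
    have hYe : ∀ a b, Y a b = if b = l then 1 else 0 := by
      rintro ⟨a, ha⟩ b
      have : a = j := by simpa using ha
      subst this
      simp [hY, Pi.single_apply]
    have h1 : ∀ a b, (Y * Yᵀ) a b = 1 := by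
      intro a b
      simp [mul_apply, hYe]
    have h2 : ∀ (Z : Matrix (Fin n) (Fin n) ℝ) a b, (Y * Z * Yᵀ) a b = Z l l := by
      intro Z a b
      simp [mul_apply, hYe]
    have h3 : Y * Xᵀ * ⅟(X * Xᵀ) * (X * Yᵀ) = Y * (Xᵀ * ((X * Xᵀ)⁻¹ * X)) * Yᵀ := by
      rw [invOf_eq_nonsing_inv]
      simp only [Matrix.mul_assoc]
    rw [Matrix.sub_apply, h1, h3, h2]
  simp_rw [key]
  rw [← Finset.mul_sum, mul_comm]
  congr 1
  rw [Finset.sum_sub_distrib]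
  have : ∑ l, (Xᵀ * ((X * Xᵀ)⁻¹ * X)) l l = S.card := by
    change trace (Xᵀ * ((X * Xᵀ)⁻¹ * X)) = _
    rw [trace_mul_comm, Matrix.mul_assoc, nonsing_inv_mul _ hu, trace_one]
    simp
  rw [this]
  simp

open Matrix in
theorem auxGram_univ {n : ℕ} (u : Fin n → Fin n → ℝ) :
    auxGram Finset.univ u = (of u).det ^ 2 := by
  unfold auxGram
  rw [sq]
  conv_rhs => rw [← det_transpose (of u), det_transpose (of u)]
  have : (of u).det * (of u).det = (of u * (of u)ᵀ).det := by rw [det_mul, det_transpose]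
  rw [this, ← det_submatrix_equiv_self (Equiv.subtypeUnivEquiv (p := fun a => a ∈ (Finset.univ : Finset (Fin n))) (fun a => Finset.mem_univ a))]
  rfl

theorem aux_incl_excl {n : ℕ} (f : Fin n → Fin n) :
    (∑ S : Finset (Fin n), if ∀ a, f a ∈ S then (-1 : ℝ) ^ (n + S.card) else 0) =
      if Function.Bijective f then 1 else 0 := by
  split_ifs with hf
  · rw [Finset.sum_eq_single Finset.univ]
    · simp [← two_mul]
    · intro S _ hS
      rw [if_neg]
      intro h
      apply hS
      ext b
      obtain ⟨a, rfl⟩ := hf.2 b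
      simp [h a]
    · simp
  · have hs : ¬ Function.Surjective f := fun h => hf (Finite.surjective_iff_bijective.mp h)
    simp only [Function.Surjective, not_forall, not_exists] at hs
    obtain ⟨b, hb⟩ := hs
    refine Finset.sum_involution (fun S _ => if b ∈ S then S.erase b else insert b S) ?_ ?_ ?_ ?_
    · intro S _
      by_cases hbS : b ∈ S
      · have h1 : (∀ a, f a ∈ S.erase b) ↔ ∀ a, f a ∈ S := by
          simp [hb]
        have h2 := Finset.card_erase_add_one hbS
        simp only [if_pos hbS, h1]
        split_ifs
        · rw [← h2]; ring
        · ring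
      · have h1 : (∀ a, f a ∈ insert b S) ↔ ∀ a, f a ∈ S := by
          simp [hb]
        have h2 := Finset.card_insert_of_notMem hbS
        simp only [if_neg hbS, h1]
        split_ifs
        · rw [h2]; ring
        · ring
    · intro S _ _
      by_cases hbS : b ∈ S
      · simp [hbS]
      · simp [hbS]
    · intro S _; exact Finset.mem_univ _
    · intro S _
      by_cases hbS : b ∈ S
      · simp [hbS]
      · simp [hbS]

open Matrix in
theorem aux_mixedDisc_eq {n : ℕ} (M : Fin n → Matrix (Fin n) (Fin n) ℝ) :
    mixedDisc M = ((n.factorial : ℝ))⁻¹ *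
      ∑ f : Fin n → Fin n, if Function.Bijective f then det (of fun a => M (f a) a) else 0 := by
  unfold mixedDisc
  congr 1
  have h : ∀ S : Finset (Fin n), (∑ i ∈ S, M i).det =
      ∑ f : Fin n → Fin n, if ∀ a, f a ∈ S then det (of fun a => M (f a) a) else 0 := by
    intro S
    have h1 := MultilinearMap.map_sum_finset
      (detRowAlternating (n := Fin n) (R := ℝ)).toMultilinearMap
      (fun (a : Fin n) (i : Fin n) => M i a) (fun _ => S)
    have h2 : (∑ i ∈ S, M i) = fun a => ∑ i ∈ S, M i a := by
      ext a b; simp [Matrix.sum_apply]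
    rw [h2]
    refine h1.trans ?_
    rw [← Finset.sum_filter]
    apply Finset.sum_congr
    · ext f; simp
    · intros; rfl
  simp_rw [h, Finset.mul_sum]
  rw [Finset.sum_comm]
  apply Finset.sum_congr rfl
  intro f _
  have h3 := aux_incl_excl f
  calc _ = (∑ S : Finset (Fin n), if ∀ a, f a ∈ S then (-1 : ℝ) ^ (n + S.card) else 0) *
        det (of fun a => M (f a) a) := by
        rw [Finset.sum_mul]
        apply Finset.sum_congr rfl
        intro S _
        split_ifs <;> simp
    _ = _ := by
        rw [h3]
        split_ifs <;> simp

open Matrix in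
theorem aux_multilinear (n : ℕ) :
    ∃ L : MultilinearMap ℝ (fun _ : Fin n => Matrix (Fin n) (Fin n) ℝ) ℝ,
      ∀ M, L M = mixedDisc M := by
  let row : Fin n → (Matrix (Fin n) (Fin n) ℝ →ₗ[ℝ] (Fin n → ℝ)) := fun k =>
    { toFun := fun X => X k, map_add' := fun _ _ => rfl, map_smul' := fun _ _ => rfl }
  classical
  let T : (Fin n → Fin n) → MultilinearMap ℝ (fun _ : Fin n => Matrix (Fin n) (Fin n) ℝ) ℝ :=
    fun f => if h : Function.Bijective f then
      (((detRowAlternating (n := Fin n) (R := ℝ)).toMultilinearMap).domDomCongr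
        (Equiv.ofBijective f h)).compLinearMap (fun i => row ((Equiv.ofBijective f h).symm i))
      else 0
  refine ⟨((n.factorial : ℝ))⁻¹ • ∑ f, T f, fun M => ?_⟩
  rw [aux_mixedDisc_eq, _root_.smul_apply, _root_.sum_apply, smul_eq_mul]
  congr 1
  apply Finset.sum_congr rfl
  intro f _
  by_cases h : Function.Bijective f
  · simp only [T, dif_pos h, if_pos h]
    rw [MultilinearMap.compLinearMap_apply, MultilinearMap.domDomCongr_apply]
    simp only [Equiv.symm_apply_apply]
    rfl
  · simp only [T, dif_neg h, if_neg h]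
    rfl

theorem aux_mixedDisc_sum {n : ℕ} {α : Type*} (s : Finset α)
    (M : Fin n → Matrix (Fin n) (Fin n) ℝ) (j : Fin n)
    (X : α → Matrix (Fin n) (Fin n) ℝ) :
    mixedDisc (Function.update M j (∑ l ∈ s, X l)) =
      ∑ l ∈ s, mixedDisc (Function.update M j (X l)) := by
  obtain ⟨L, hL⟩ := aux_multilinear n
  simp_rw [← hL]
  exact L.map_update_sum s j X M

theorem aux_mixedDisc_perm {n : ℕ} (M : Fin n → Matrix (Fin n) (Fin n) ℝ)
    (σ : Equiv.Perm (Fin n)) : mixedDisc (fun j => M (σ j)) = mixedDisc M := by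
  unfold mixedDisc
  congr 1
  apply Fintype.sum_equiv (Equiv.finsetCongr σ)
  intro S
  simp

open Matrix in
theorem aux_mixedDisc_conj {n : ℕ} (M : Fin n → Matrix (Fin n) (Fin n) ℝ)
    (C : Matrix (Fin n) (Fin n) ℝ) :
    mixedDisc (fun j => Cᵀ * M j * C) = C.det ^ 2 * mixedDisc M := by
  unfold mixedDisc
  rw [mul_left_comm]
  congr 1
  rw [Finset.mul_sum]
  apply Finset.sum_congr rfl
  intro S _
  rw [← Finset.sum_mul, ← Finset.mul_sum, det_mul, det_mul, det_transpose]
  ring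

open Matrix in
theorem aux_mixedDisc_rankOne {n : ℕ} (u : Fin n → Fin n → ℝ) :
    mixedDisc (fun j => vecMulVec (u j) (u j)) = ((n.factorial : ℝ))⁻¹ * (of u).det ^ 2 := by
  unfold mixedDisc
  congr 1
  have h : ∀ S : Finset (Fin n), ∑ i ∈ S, vecMulVec (u i) (u i) =
      (of u)ᵀ * diagonal (fun i => if i ∈ S then 1 else 0) * of u := by
    intro S
    ext a b
    rw [Matrix.sum_apply, Matrix.mul_apply]
    simp [vecMulVec_apply, Matrix.mul_diagonal]
  simp_rw [h, det_mul, det_diagonal, det_transpose]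
  rw [Finset.sum_eq_single Finset.univ]
  · simp [← two_mul]; ring
  · intro S _ hS
    have : ∃ a, a ∉ S := by
      by_contra hc
      push Not at hc
      exact hS (by ext a; simp [hc a])
    obtain ⟨a, ha⟩ := this
    rw [Finset.prod_eq_zero (Finset.mem_univ a) (by simp [ha])]
    ring
  · simp

open Matrix in
theorem aux_mixedDisc_gram {n : ℕ} (k : ℕ) : ∀ (S : Finset (Fin n)) (u : Fin n → Fin n → ℝ),
    S.card + k = n →
    (n.factorial : ℝ) * mixedDisc (fun j => if j ∈ S then vecMulVec (u j) (u j) else 1) =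
      (k.factorial : ℝ) * auxGram S u := by
  have hn : (n.factorial : ℝ) ≠ 0 := by exact_mod_cast n.factorial_ne_zero
  induction k with
  | zero =>
    intro S u hS
    have : S = Finset.univ := by
      apply Finset.eq_univ_of_card
      simpa using hS
    subst this
    simp only [Finset.mem_univ, if_true]
    rw [aux_mixedDisc_rankOne, auxGram_univ]
    field_simp
    simp
  | succ k ih =>
    intro S u hS
    have : ∃ j, j ∉ S := by
      by_contra hc
      push Not at hc
      have : S = Finset.univ := by ext a; simp [hc a]
      rw [this] at hS
      simp at hS
    obtain ⟨j, hj⟩ := this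
    have h1 : (1 : Matrix (Fin n) (Fin n) ℝ) =
        ∑ l : Fin n, vecMulVec (Pi.single l 1) (Pi.single l 1) := by
      ext a b
      rw [Matrix.sum_apply]
      simp [vecMulVec_apply, Pi.single_apply, Matrix.one_apply]
    have h2 : (fun i => if i ∈ S then vecMulVec (u i) (u i) else 1) =
        Function.update (fun i => if i ∈ S then vecMulVec (u i) (u i) else 1) j
          (∑ l : Fin n, vecMulVec (Pi.single l 1) (Pi.single l 1)) := by
      rw [← h1]
      ext1 i
      by_cases hi : i = j
      · subst hi; simp [hj]
      · simp [hi]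
    rw [h2, aux_mixedDisc_sum, Finset.mul_sum]
    have h3 : ∀ l : Fin n, (n.factorial : ℝ) * mixedDisc (Function.update
        (fun i => if i ∈ S then vecMulVec (u i) (u i) else 1) j
          (vecMulVec (Pi.single l 1) (Pi.single l 1))) =
        (k.factorial : ℝ) * auxGram (S ∪ {j}) (Function.update u j (Pi.single l 1)) := by
      intro l
      rw [← ih (S ∪ {j}) (Function.update u j (Pi.single l 1))]
      · congr 2
        ext1 i
        by_cases hi : i = j
        · subst hi; simp
        · simp [hi]
      · rw [Finset.card_union_of_disjoint (by simpa using hj)]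
        simp; omega
    simp_rw [h3]
    rw [← Finset.mul_sum, auxGram_step S j hj, Nat.factorial_succ]
    have hS' : (n : ℝ) = S.card + (k + 1) := by exact_mod_cast hS.symm
    rw [hS']
    push_cast
    ring

/-- Induction principle: reduce a slotwise additive property to rank one matrices. -/
theorem aux_rankOne_induction {n : ℕ} (P : (Fin n → Matrix (Fin n) (Fin n) ℝ) → Prop)
    (h1 : ∀ u : Fin n → Fin n → ℝ, P (fun j => Matrix.vecMulVec (u j) (u j)))
    (h2 : ∀ (M : Fin n → Matrix (Fin n) (Fin n) ℝ) (j : Fin n) (m : ℕ)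
      (X : Fin m → Matrix (Fin n) (Fin n) ℝ), P (Function.update M j 0) →
      (∀ l, P (Function.update M j (X l))) →
      P (Function.update M j (∑ l, X l)))
    (M : Fin n → Matrix (Fin n) (Fin n) ℝ) (hM : ∀ j, (M j).PosSemidef) : P M := by
  have key : ∀ (J : Finset (Fin n)) (M : Fin n → Matrix (Fin n) (Fin n) ℝ),
      (∀ j, (M j).PosSemidef) → (∀ j, j ∉ J → ∃ v, M j = Matrix.vecMulVec v v) → P M := by
    intro J
    induction J using Finset.induction_on with
    | empty =>
      intro M _ h
      choose u hu using fun j => h j (Finset.notMem_empty j)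
      rw [show M = fun j => Matrix.vecMulVec (u j) (u j) from funext hu]
      exact h1 u
    | insert j J hj ih =>
      intro M hM h
      obtain ⟨m, v, hv⟩ := Matrix.posSemidef_iff_eq_sum_vecMulVec.mp (hM j)
      simp only [star_trivial] at hv
      have : M = Function.update M j (∑ l, Matrix.vecMulVec (v l) (v l)) := by
        rw [← hv, Function.update_eq_self]
      rw [this]
      have hr : ∀ v : Fin n → ℝ, P (Function.update M j (Matrix.vecMulVec v v)) := by
       intro v
       apply ih
       · intro i
         by_cases hi : i = j
         · subst hi
           have := Matrix.posSemidef_vecMulVec_self_star v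
           simpa using this
         · simpa [hi] using hM i
       · intro i hiJ
         by_cases hi : i = j
         · subst hi; exact ⟨v, by simp⟩
         · obtain ⟨w, hw⟩ := h i (by simp [hi, hiJ])
           exact ⟨w, by simpa [hi] using hw⟩
      exact h2 M j m _ (by simpa using hr 0) fun l => hr (v l)
  exact key Finset.univ M hM (by simp)

theorem aux_mixedDisc_nonneg {n : ℕ} (M : Fin n → Matrix (Fin n) (Fin n) ℝ)
    (hM : ∀ j, (M j).PosSemidef) : 0 ≤ mixedDisc M := by
  apply aux_rankOne_induction (fun M => 0 ≤ mixedDisc M) _ _ M hM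
  · intro u
    simp only [aux_mixedDisc_rankOne]
    positivity
  · intro M j m X _ h
    simp only [aux_mixedDisc_sum]
    exact Finset.sum_nonneg fun l _ => h l

/-- Normalized mixed discriminant with the slots outside `S` filled by the identity. -/
noncomputable def auxE {n : ℕ} (M : Fin n → Matrix (Fin n) (Fin n) ℝ) (S : Finset (Fin n)) : ℝ :=
  (n.factorial : ℝ) / ((n - S.card).factorial : ℝ) * mixedDisc (fun j => if j ∈ S then M j else 1)

theorem auxE_nonneg {n : ℕ} (M : Fin n → Matrix (Fin n) (Fin n) ℝ)
    (hM : ∀ j, (M j).PosSemidef) (S : Finset (Fin n)) : 0 ≤ auxE M S := by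
  unfold auxE
  apply mul_nonneg (by positivity)
  apply aux_mixedDisc_nonneg
  intro j
  split_ifs
  · exact hM j
  · exact Matrix.PosSemidef.one

theorem auxE_rankOne {n : ℕ} (u : Fin n → Fin n → ℝ) (S : Finset (Fin n)) :
    auxE (fun j => Matrix.vecMulVec (u j) (u j)) S = auxGram S u := by
  unfold auxE
  have hc : S.card ≤ n := by simpa using Finset.card_le_univ S
  have := aux_mixedDisc_gram (n - S.card) S u (by omega)
  have h0 : ((n - S.card).factorial : ℝ) ≠ 0 := by exact_mod_cast Nat.factorial_ne_zero _
  rw [div_mul_eq_mul_div, this]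
  field_simp

theorem auxE_update_mem {n : ℕ} (M : Fin n → Matrix (Fin n) (Fin n) ℝ) (S : Finset (Fin n))
    (j : Fin n) (hj : j ∈ S) {m : ℕ} (X : Fin m → Matrix (Fin n) (Fin n) ℝ) :
    auxE (Function.update M j (∑ l, X l)) S = ∑ l, auxE (Function.update M j (X l)) S := by
  unfold auxE
  rw [← Finset.mul_sum]
  congr 1
  have h : ∀ Y, (fun i => if i ∈ S then Function.update M j Y i else 1) =
      Function.update (fun i => if i ∈ S then M i else 1) j Y := by
    intro Y
    ext1 i
    by_cases hi : i = j
    · subst hi; simp [hj]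
    · simp [hi]
  simp_rw [h]
  exact aux_mixedDisc_sum _ _ _ _

theorem auxE_update_notMem {n : ℕ} (M : Fin n → Matrix (Fin n) (Fin n) ℝ) (S : Finset (Fin n))
    (j : Fin n) (hj : j ∉ S) (X : Matrix (Fin n) (Fin n) ℝ) :
    auxE (Function.update M j X) S = auxE M S := by
  unfold auxE
  congr 2
  ext1 i
  by_cases hi : i = j
  · subst hi; simp [hj]
  · simp [hi]

theorem auxE_empty {n : ℕ} (M : Fin n → Matrix (Fin n) (Fin n) ℝ) : auxE M ∅ = 1 := by
  have h1 : auxE M ∅ = auxE (fun j : Fin n => Matrix.vecMulVec (0 : Fin n → ℝ) 0) ∅ := by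
    unfold auxE; simp
  rw [h1]
  rw [auxE_rankOne (fun _ => 0)]
  simp [auxGram]

theorem auxE_union {n : ℕ} (S T : Finset (Fin n)) (h : Disjoint S T)
    (M : Fin n → Matrix (Fin n) (Fin n) ℝ)
    (hM : ∀ j, (M j).PosSemidef) : auxE M (S ∪ T) ≤ auxE M S * auxE M T := by
  apply aux_rankOne_induction (fun M => auxE M (S ∪ T) ≤ auxE M S * auxE M T) _ _ M hM
  · intro u
    simp only [auxE_rankOne]
    exact auxGram_fischer S T h u
  · intro M j m X h0 hX
    by_cases hjS : j ∈ S
    · have hjT : j ∉ T := Finset.disjoint_left.mp h hjS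
      have hjU : j ∈ S ∪ T := Finset.mem_union_left _ hjS
      simp only [auxE_update_notMem _ T j hjT] at hX ⊢
      rw [auxE_update_mem _ _ j hjU, auxE_update_mem _ _ j hjS, Finset.sum_mul]
      exact Finset.sum_le_sum fun l _ => hX l
    by_cases hjT : j ∈ T
    · have hjU : j ∈ S ∪ T := Finset.mem_union_right _ hjT
      simp only [auxE_update_notMem _ S j hjS] at hX ⊢
      rw [auxE_update_mem _ _ j hjU, auxE_update_mem _ _ j hjT, Finset.mul_sum]
      exact Finset.sum_le_sum fun l _ => hX l
    · have hjU : j ∉ S ∪ T := by simp [hjS, hjT]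
      simp only [auxE_update_notMem _ _ j hjS, auxE_update_notMem _ _ j hjT,
        auxE_update_notMem _ _ j hjU] at h0 ⊢
      exact h0

theorem auxE_biUnion {n : ℕ} {κ : Type*} [DecidableEq κ] (K : Finset κ) (S : κ → Finset (Fin n))
    (hS : ∀ a b, a ≠ b → Disjoint (S a) (S b))
    (M : Fin n → Matrix (Fin n) (Fin n) ℝ)
    (hM : ∀ j, (M j).PosSemidef) : auxE M (K.biUnion S) ≤ ∏ k ∈ K, auxE M (S k) := by
  induction K using Finset.induction_on with
  | empty => simp [auxE_empty]
  | insert k K hk ih =>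
    rw [Finset.biUnion_insert, Finset.prod_insert hk]
    refine (auxE_union _ _ ?_ M hM).trans (mul_le_mul_of_nonneg_left ih (auxE_nonneg M hM _))
    rw [Finset.disjoint_biUnion_right]
    intro b hb
    exact hS k b (fun h => hk (h ▸ hb))

open Matrix in
theorem aux_core (m n : ℕ) (c : Fin n → Option (Fin (m + 1))) (i : Fin (m + 1) → ℕ)
    (hc : ∀ k, (Finset.univ.filter (fun j => c j = some k)).card = i k)
    (A : Matrix (Fin n) (Fin n) ℝ) (B : Fin (m + 1) → Matrix (Fin n) (Fin n) ℝ)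
    (hA : A.PosSemidef) (hB : ∀ k, (B k).PosSemidef) :
    A.det ^ m * mixedDisc (fun j => (c j).elim A B) ≤
    ((n.factorial : ℝ) ^ m * ((n - ∑ k, i k).factorial : ℝ) /
        ((∏ j, (n - i j).factorial : ℕ) : ℝ)) *
      ∏ k, mixedDisc (fun j : Fin n => if c j = some k then B k else A) := by
  have hnn : ∀ k, 0 ≤ mixedDisc (fun j : Fin n => if c j = some k then B k else A) := by
    intro k
    apply aux_mixedDisc_nonneg
    intro j
    split_ifs
    · exact hB k
    · exact hA
  have hp : ∀ p : ℕ, (p.factorial : ℝ) ≠ 0 := fun p => by exact_mod_cast p.factorial_ne_zero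
  by_cases hd : A.det = 0
  · rcases Nat.eq_zero_or_pos m with rfl | hm
    · have hs : ∑ k, i k = i 0 := by simp
      have hs2 : ∏ k, (n - i k).factorial = (n - i 0).factorial := by simp
      have hs3 : ∏ k, mixedDisc (fun j : Fin n => if c j = some k then B k else A) =
          mixedDisc (fun j : Fin n => if c j = some 0 then B 0 else A) := by simp
      rw [hs, hs2, hs3, pow_zero, pow_zero, one_mul, one_mul, div_self (hp _), one_mul]
      apply le_of_eq
      congr 1
      ext1 j
      rcases hcj : c j with _ | k
      · simp
      · have : k = 0 := by apply Fin.ext; omega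
        subst this
        simp
    · rw [hd, zero_pow hm.ne', zero_mul]
      exact mul_nonneg (by positivity) (Finset.prod_nonneg fun k _ => hnn k)
  obtain ⟨C, hC, hu⟩ := aux_exists_factor (hA.posDef_iff_det_ne_zero.mpr hd)
  have hiC : C⁻¹ * C = 1 := nonsing_inv_mul C hu
  set B' : Fin (m + 1) → Matrix (Fin n) (Fin n) ℝ := fun k => (C⁻¹)ᵀ * B k * C⁻¹ with hB'
  have hBB : ∀ k, B k = Cᵀ * B' k * C := by
    intro k
    have : Cᵀ * ((C⁻¹)ᵀ * B k * C⁻¹) * C = (Cᵀ * (C⁻¹)ᵀ) * B k * (C⁻¹ * C) := by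
      simp only [Matrix.mul_assoc]
    simp only [hB', this, ← transpose_mul, hiC, transpose_one, Matrix.one_mul, Matrix.mul_one]
  have hBp : ∀ k, (B' k).PosSemidef := by
    intro k
    have := (hB k).conjTranspose_mul_mul_same C⁻¹
    simpa [hB'] using this
  have hL : mixedDisc (fun j => (c j).elim A B) =
      C.det ^ 2 * mixedDisc (fun j => (c j).elim 1 B') := by
    rw [← aux_mixedDisc_conj]
    congr 1
    ext1 j
    rcases c j with _ | k
    · simp [hC]
    · exact hBB k
  have hR : ∀ k, mixedDisc (fun j : Fin n => if c j = some k then B k else A) =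
      C.det ^ 2 * mixedDisc (fun j : Fin n => if c j = some k then B' k else 1) := by
    intro k
    rw [← aux_mixedDisc_conj]
    congr 1
    ext1 j
    split_ifs
    · exact hBB k
    · simp [hC]
  have hdet : A.det = C.det ^ 2 := by rw [hC, det_mul, det_transpose, sq]
  set S : Fin (m + 1) → Finset (Fin n) := fun k => Finset.univ.filter (fun j => c j = some k)
    with hS
  have hdis : ∀ a b, a ≠ b → Disjoint (S a) (S b) := by
    intro a b hab
    rw [Finset.disjoint_left]
    intro j hj hj'
    simp only [hS, Finset.mem_filter, Finset.mem_univ, true_and] at hj hj'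
    rw [hj] at hj'
    exact hab (Option.some.inj hj')
  have key := auxE_biUnion Finset.univ S hdis (fun j => (c j).elim 1 B') (by
    intro j
    rcases c j with _ | k
    · exact PosSemidef.one
    · exact hBp k)
  have hcard : (Finset.univ.biUnion S).card = ∑ k, i k := by
    rw [Finset.card_biUnion (fun a _ b _ hab => hdis a b hab)]
    exact Finset.sum_congr rfl fun k _ => hc k
  have hE1 : auxE (fun j => (c j).elim 1 B') (Finset.univ.biUnion S) =
      (n.factorial : ℝ) / ((n - ∑ k, i k).factorial : ℝ) *
        mixedDisc (fun j => (c j).elim 1 B') := by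
    unfold auxE
    rw [hcard]
    congr 2
    ext1 j
    rcases hcj : c j with _ | k
    · simp [hcj]
    · simp [hS, hcj]
  have hE2 : ∀ k, auxE (fun j => (c j).elim 1 B') (S k) =
      (n.factorial : ℝ) / ((n - i k).factorial : ℝ) *
        mixedDisc (fun j : Fin n => if c j = some k then B' k else 1) := by
    intro k
    unfold auxE
    rw [show (S k).card = i k from hc k]
    congr 2
    ext1 j
    by_cases h : c j = some k
    · simp [hS, h]
    · simp [hS, h]
  rw [hE1] at key
  simp_rw [hE2] at key
  simp_rw [hL, hR, hdet]
  rw [Finset.prod_mul_distrib] at key ⊢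
  rw [Finset.prod_div_distrib] at key
  simp only [Finset.prod_const, Finset.card_univ, Fintype.card_fin] at key ⊢
  push_cast
  set X := mixedDisc (fun j => (c j).elim 1 B')
  set Y := ∏ k, mixedDisc (fun j : Fin n => if c j = some k then B' k else 1)
  set q : ℝ := ((n - ∑ k, i k).factorial : ℝ)
  set N : ℝ := (n.factorial : ℝ)
  set p : ℝ := ∏ k, ((n - i k).factorial : ℝ)
  have hq : 0 < q := by positivity
  have hN : 0 < N := by positivity
  have hpp : 0 < p := by positivity
  have key2 : X ≤ N ^ m * q / p * Y := by
    have h3 : q / N * (N / q * X) ≤ q / N * (N ^ (m + 1) / p * Y) :=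
      mul_le_mul_of_nonneg_left key (by positivity)
    have h4 : q / N * (N / q * X) = X := by field_simp
    have h5 : q / N * (N ^ (m + 1) / p * Y) = N ^ m * q / p * Y := by
      rw [pow_succ]; field_simp
    rwa [h4, h5] at h3
  calc (C.det ^ 2) ^ m * (C.det ^ 2 * X) = (C.det ^ 2) ^ (m + 1) * X := by ring
    _ ≤ (C.det ^ 2) ^ (m + 1) * (N ^ m * q / p * Y) :=
        mul_le_mul_of_nonneg_left key2 (by positivity)
    _ = _ := by ring

theorem aux_card_get {α : Type*} [DecidableEq α] (L : List α) (a : α) :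
    (Finset.univ.filter (fun j : Fin L.length => L.get j = a)).card =
      L.countP (fun b => decide (b = a)) := by
  have := Fin.card_filter_univ_eq_vector_get_eq_count a (⟨L, rfl⟩ : List.Vector α L.length)
  simp only [List.Vector.toList, List.count] at this
  have h2 : L.countP (fun b => decide (b = a)) = L.countP (fun b => b == a) := by
    apply List.countP_congr
    intro x _
    simp
  rw [h2, ← this]
  congr 1

theorem aux_blocks_map {α β : Type*} {m : ℕ} (i : Fin m → ℕ) (B : Fin m → α) (g : α → β) :
    (blocks i B).map g = blocks i (fun k => g (B k)) := by
  unfold blocks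
  rw [List.map_flatten, List.map_ofFn]
  congr 2
  ext1 k
  simp

theorem aux_mixedDisc_two {n : ℕ} (p q : Fin n → Prop) [DecidablePred p] [DecidablePred q]
    (h : (Finset.univ.filter p).card = (Finset.univ.filter q).card)
    (A B : Matrix (Fin n) (Fin n) ℝ) :
    mixedDisc (fun j => if p j then B else A) = mixedDisc (fun j => if q j then B else A) := by
  have hc : Fintype.card {x // p x} = Fintype.card {x // q x} := by
    rw [Fintype.card_subtype, Fintype.card_subtype, h]
  have e := Fintype.equivOfCardEq hc
  rw [← aux_mixedDisc_perm (fun j => if q j then B else A) (e.extendSubtype)]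
  congr 1
  ext1 j
  by_cases hj : p j
  · rw [if_pos hj, if_pos (e.extendSubtype_mem j hj)]
  · rw [if_neg hj, if_neg (e.extendSubtype_not_mem j hj)]

theorem lehmann_xiao_remark (m n : ℕ) (hm : 1 ≤ m) (hn : 2 ≤ n)
    (i : Fin m → ℕ) (hi : ∑ k, i k ≤ n)
    (A : Matrix (Fin n) (Fin n) ℝ) (B : Fin m → Matrix (Fin n) (Fin n) ℝ)
    (hA : A.PosSemidef) (hB : ∀ k, (B k).PosSemidef) :
    A.det ^ (m - 1) *
      mixedDisc (fun j : Fin n =>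
        (blocks i B ++ List.replicate (n - ∑ k, i k) A).getD (j : ℕ) 0) ≤
    ((n.factorial : ℝ) ^ (m - 1) * ((n - ∑ k, i k).factorial : ℝ) /
        ((∏ j, (n - i j).factorial : ℕ) : ℝ)) *
      ∏ k, mixedDisc (fun j : Fin n => if (j : ℕ) < i k then B k else A) := by
  obtain ⟨m, rfl⟩ : ∃ m', m = m' + 1 := ⟨m - 1, by omega⟩
  set L : List (Option (Fin (m + 1))) :=
    blocks i some ++ List.replicate (n - ∑ k, i k) none with hL
  have hlen : L.length = n := by
    simp only [hL, blocks, List.length_append, List.length_flatten, List.length_replicate,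
      List.map_ofFn, List.sum_ofFn, Function.comp_apply]
    omega
  set c : Fin n → Option (Fin (m + 1)) := fun j => L.get (Fin.cast hlen.symm j) with hcdef
  have hc : ∀ k, (Finset.univ.filter (fun j => c j = some k)).card = i k := by
    intro k
    have h1 : (Finset.univ.filter (fun j => c j = some k)).card =
        (Finset.univ.filter (fun j : Fin L.length => L.get j = some k)).card := by
      apply Finset.card_bij (fun j _ => Fin.cast hlen.symm j)
      · intro j hj
        simpa [hcdef] using hj
      · intro a _ b _ hab
        simpa using hab
      · intro b hb
        exact ⟨Fin.cast hlen b, by simpa [hcdef] using hb, by simp⟩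
    rw [h1, aux_card_get, hL, List.countP_append, blocks, List.countP_flatten, List.map_ofFn,
      List.sum_ofFn]
    simp [List.countP_replicate]
  have hM : (fun j : Fin n =>
        (blocks i B ++ List.replicate (n - ∑ k, i k) A).getD (j : ℕ) 0) =
      fun j => (c j).elim A B := by
    have h1 : blocks i B ++ List.replicate (n - ∑ k, i k) A =
        L.map (fun o => o.elim A B) := by
      rw [hL, List.map_append, aux_blocks_map]
      simp
    ext1 j
    have hj : (j : ℕ) < L.length := by rw [hlen]; exact j.2
    rw [h1, List.getD_eq_getElem _ _ (by simpa using hj)]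
    simp [hcdef]
  have hR : ∀ k, mixedDisc (fun j : Fin n => if (j : ℕ) < i k then B k else A) =
      mixedDisc (fun j : Fin n => if c j = some k then B k else A) := by
    intro k
    apply aux_mixedDisc_two
    rw [hc k]
    have : i k ≤ n := (Finset.single_le_sum (fun a _ => Nat.zero_le (i a))
      (Finset.mem_univ k)).trans hi
    rw [Fin.card_filter_val_lt]
    omega
  rw [hM]
  simp_rw [hR]
  exact aux_core m n c i hc A B hA hB
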